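/- Let Γ be a finite simplicial graph. The automorphism group Aut(C_Γ) of the right-angled Coxeter group C_Γ is boundedly generated if and only if every vertex of Γ is non-adjacent to at most one other vertex of Γ. -/

import Mathlib

/-- The set of commutation relators defining a graph product. -/
def graphProdRels {V : Type*} (Γ : SimpleGraph V) (G : V → Type*) [∀ w, Group (G w)] :
    Set (Monoid.CoprodI G) :=
  {x | ∃ (u v : V) (_ : Γ.Adj u v) (g : G u) (h : G v),
    x = Monoid.CoprodI.of g * Monoid.CoprodI.of h *
      (Monoid.CoprodI.of g)⁻¹ * (Monoid.CoprodI.of h)⁻¹}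

/-- The graph product of the family of groups `G` over the simplicial graph `Γ`. -/
def GraphProduct {V : Type*} (Γ : SimpleGraph V) (G : V → Type*) [∀ w, Group (G w)] :=
  Monoid.CoprodI G ⧸ Subgroup.normalClosure (graphProdRels Γ G)

instance {V : Type*} (Γ : SimpleGraph V) (G : V → Type*) [∀ w, Group (G w)] :
    Group (GraphProduct Γ G) :=
  inferInstanceAs (Group (Monoid.CoprodI G ⧸ Subgroup.normalClosure (graphProdRels Γ G)))

/-- The canonical map from a vertex group into the graph product. -/
def GraphProduct.of {V : Type*} (Γ : SimpleGraph V) (G : V → Type*) [∀ w, Group (G w)]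
    (u : V) : G u →* GraphProduct Γ G :=
  (QuotientGroup.mk' (Subgroup.normalClosure (graphProdRels Γ G))).comp Monoid.CoprodI.of

/-- The vertex subgroup of the graph product at the vertex `u`. -/
def vertexSubgroup {V : Type*} (Γ : SimpleGraph V) (G : V → Type*) [∀ w, Group (G w)]
    (u : V) : Subgroup (GraphProduct Γ G) :=
  (GraphProduct.of Γ G u).range

/-- An automorphism of the graph product is conjugating if it sends each vertex subgroup to
a conjugate of a vertex subgroup. -/
def IsConjugating {V : Type*} (Γ : SimpleGraph V) (G : V → Type*) [∀ w, Group (G w)]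
    (φ : MulAut (GraphProduct Γ G)) : Prop :=
  ∀ u : V, ∃ (v : V) (g : GraphProduct Γ G),
    Subgroup.map φ.toMonoidHom (vertexSubgroup Γ G u) =
      Subgroup.map (MulAut.conj g).toMonoidHom (vertexSubgroup Γ G v)

/-- An automorphism of the graph product is in `PConjAut` if it sends each vertex subgroup to
a conjugate of itself. -/
def IsPConjugating {V : Type*} (Γ : SimpleGraph V) (G : V → Type*) [∀ w, Group (G w)]
    (φ : MulAut (GraphProduct Γ G)) : Prop :=
  ∀ u : V, ∃ g : GraphProduct Γ G,
    Subgroup.map φ.toMonoidHom (vertexSubgroup Γ G u) =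
      Subgroup.map (MulAut.conj g).toMonoidHom (vertexSubgroup Γ G u)

/-- A vertex is universal if it is adjacent to every other vertex. -/
def IsUniversal {V : Type*} (Γ : SimpleGraph V) (u : V) : Prop :=
  ∀ v : V, v ≠ u → Γ.Adj u v

/-- Some vertex is non-adjacent to at least two other vertices. -/
def HasVertexWithTwoNonNeighbors {V : Type*} (Γ : SimpleGraph V) : Prop :=
  ∃ u v w : V, v ≠ w ∧ v ≠ u ∧ w ≠ u ∧ ¬Γ.Adj u v ∧ ¬Γ.Adj u w

/-- A group `G` is SQ-universal if every countable group embeds into a quotient of `G`. -/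
def SQUniversal (G : Type*) [Group G] : Prop :=
  ∀ (Q : Type) [Group Q] [Countable Q],
    ∃ (N : Subgroup G) (hN : N.Normal),
      haveI := hN
      ∃ f : Q →* G ⧸ N, Function.Injective f

/-- A quasimorphism on a group. -/
def IsQuasimorphism {H : Type*} [Group H] (f : H → ℝ) : Prop :=
  ∃ C : ℝ, 0 ≤ C ∧ ∀ g h : H, |f (g * h) - f g - f h| ≤ C

/-- A homogeneous map on a group. -/
def IsHomogeneous {H : Type*} [Group H] (f : H → ℝ) : Prop :=
  ∀ (g : H) (k : ℤ), f (g ^ k) = (k : ℝ) * f g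

/-- The space of homogeneous quasimorphisms of `H` is infinite-dimensional, expressed as: it is
not contained in the span of any finite set of functions. -/
def HasManyQuasimorphisms (H : Type*) [Group H] : Prop :=
  ¬ ∃ s : Finset (H → ℝ), ∀ f : H → ℝ, IsQuasimorphism f → IsHomogeneous f →
      f ∈ Submodule.span ℝ (s : Set (H → ℝ))

/-- A group virtually has many quasimorphisms if some finite-index subgroup has an
infinite-dimensional space of homogeneous quasimorphisms. -/
def VirtuallyManyQuasimorphisms (G : Type*) [Group G] : Prop :=
  ∃ H : Subgroup G, H.FiniteIndex ∧ HasManyQuasimorphisms H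

/-- A group is boundedly generated if it is the product of finitely many cyclic subgroups. -/
def BoundedlyGenerated (G : Type*) [Group G] : Prop :=
  ∃ l : List G, ∀ g : G, ∃ m : List ℤ, m.length = l.length ∧
    g = (List.zipWith (fun x (k : ℤ) => x ^ k) l m).prod

/-- A group is large if a finite-index subgroup surjects onto a nonabelian free group. -/
def IsLarge (G : Type*) [Group G] : Prop :=
  ∃ H : Subgroup G, H.FiniteIndex ∧ ∃ f : H →* FreeGroup (Fin 2), Function.Surjective f

/-- A group is virtually free abelian if it has a finite-index subgroup isomorphic to `ℤⁿ`. -/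
def VirtuallyFreeAbelian (G : Type*) [Group G] : Prop :=
  ∃ H : Subgroup G, H.FiniteIndex ∧ ∃ n : ℕ, Nonempty (H ≃* Multiplicative (Fin n → ℤ))

/-- The relators of a right-angled Coxeter group. -/
def racgRels {V : Type*} (Γ : SimpleGraph V) : Set (FreeGroup V) :=
  {w | (∃ v : V, w = FreeGroup.of v * FreeGroup.of v) ∨
    ∃ u v : V, Γ.Adj u v ∧ w = (FreeGroup.of u * FreeGroup.of v) ^ 2}

/-- The right-angled Coxeter group of a simplicial graph. -/
def RACG {V : Type*} (Γ : SimpleGraph V) := PresentedGroup (racgRels Γ)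

instance {V : Type*} (Γ : SimpleGraph V) : Group (RACG Γ) :=
  inferInstanceAs (Group (PresentedGroup (racgRels Γ)))

/-- The augmentation ideal of the group algebra of `W` over the field with two elements. -/
noncomputable def augmentation (W : Type*) [Group W] :
    Submodule (ZMod 2) (MonoidAlgebra (ZMod 2) W) :=
  Submodule.span (ZMod 2) (Set.range fun g : W => MonoidAlgebra.of (ZMod 2) W g - 1)

/-- The algebra endomorphism of the group algebra induced by an automorphism of the group. -/
noncomputable def groupAlgebraMap {W : Type*} [Group W] (φ : MulAut W) :
    MonoidAlgebra (ZMod 2) W →ₐ[ZMod 2] MonoidAlgebra (ZMod 2) W :=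
  MonoidAlgebra.lift (ZMod 2) (MonoidAlgebra (ZMod 2) W) W
    ((MonoidAlgebra.of (ZMod 2) W).comp φ.toMonoidHom)

section GroupAlgebra

variable {W : Type*} [Group W]

lemma of_sub_one_mem_augmentation (g : W) :
    MonoidAlgebra.of (ZMod 2) W g - 1 ∈ augmentation W :=
  Submodule.subset_span ⟨g, rfl⟩

lemma groupAlgebraMap_of (φ : MulAut W) (g : W) :
    groupAlgebraMap φ (MonoidAlgebra.of (ZMod 2) W g) = MonoidAlgebra.of (ZMod 2) W (φ g) := by
  simp [groupAlgebraMap]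

lemma groupAlgebraMap_one : groupAlgebraMap (1 : MulAut W) = AlgHom.id _ _ := by
  ext g
  simp [groupAlgebraMap]

lemma groupAlgebraMap_mul (φ ψ : MulAut W) :
    groupAlgebraMap (φ * ψ) = (groupAlgebraMap φ).comp (groupAlgebraMap ψ) := by
  ext g
  simp [groupAlgebraMap]

lemma groupAlgebraMap_pow (φ : MulAut W) (n : ℕ) :
    (groupAlgebraMap (φ ^ n)).toLinearMap =
      ((groupAlgebraMap φ).toLinearMap : Module.End (ZMod 2) (MonoidAlgebra (ZMod 2) W)) ^ n := by
  induction n with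
  | zero => rw [pow_zero, pow_zero, groupAlgebraMap_one]; rfl
  | succ n ih => rw [pow_succ, pow_succ, groupAlgebraMap_mul, ← ih]; rfl

lemma groupAlgebraMap_mem_pow (φ : MulAut W) (k : ℕ) {a : MonoidAlgebra (ZMod 2) W}
    (ha : a ∈ augmentation W ^ k) : groupAlgebraMap φ a ∈ augmentation W ^ k := by
  have h1 : Submodule.map (groupAlgebraMap φ).toLinearMap (augmentation W) ≤ augmentation W := by
    rw [augmentation, Submodule.map_span, Submodule.span_le]
    rintro _ ⟨_, ⟨g, rfl⟩, rfl⟩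
    have : (groupAlgebraMap φ).toLinearMap (MonoidAlgebra.of (ZMod 2) W g - 1) =
        MonoidAlgebra.of (ZMod 2) W (φ g) - 1 := by
      rw [AlgHom.toLinearMap_apply, map_sub, groupAlgebraMap_of, map_one]
    rw [this]
    exact of_sub_one_mem_augmentation _
  have h2 := pow_le_pow_left' h1 k
  rw [← Submodule.map_pow] at h2
  exact h2 ⟨a, ha, rfl⟩

lemma of_mul_mem_augmentation (g : W) {a : MonoidAlgebra (ZMod 2) W} (ha : a ∈ augmentation W) :
    MonoidAlgebra.of (ZMod 2) W g * a ∈ augmentation W := by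
  induction ha using Submodule.span_induction with
  | mem x hx =>
    obtain ⟨h, rfl⟩ := hx
    have : MonoidAlgebra.of (ZMod 2) W g * (MonoidAlgebra.of (ZMod 2) W h - 1) =
        (MonoidAlgebra.of (ZMod 2) W (g * h) - 1) - (MonoidAlgebra.of (ZMod 2) W g - 1) := by
      rw [map_mul]; noncomm_ring
    exact this ▸ sub_mem (of_sub_one_mem_augmentation _) (of_sub_one_mem_augmentation _)
  | zero => simp
  | add x y _ _ hx hy => rw [mul_add]; exact add_mem hx hy
  | smul c x _ hx => rw [mul_smul_comm]; exact Submodule.smul_mem _ _ hx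

lemma of_mul_mem_augmentation_sq (g : W) {a : MonoidAlgebra (ZMod 2) W}
    (ha : a ∈ augmentation W ^ 2) :
    MonoidAlgebra.of (ZMod 2) W g * a ∈ augmentation W ^ 2 := by
  rw [sq] at ha ⊢
  refine Submodule.mul_induction_on ha (fun x hx y hy => ?_) (fun x y hx hy => ?_)
  · rw [← mul_assoc]
    exact Submodule.mul_mem_mul (of_mul_mem_augmentation g hx) hy
  · rw [mul_add]; exact add_mem hx hy

/-- The automorphisms of `W` acting trivially modulo the `k`-th power of the augmentation ideal. -/
def congruenceAut (W : Type*) [Group W] (k : ℕ) : Subgroup (MulAut W) where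
  carrier := {φ | ∀ g : W, MonoidAlgebra.of (ZMod 2) W (φ g) - MonoidAlgebra.of (ZMod 2) W g ∈
    augmentation W ^ k}
  one_mem' g := by simp
  mul_mem' {φ ψ} hφ hψ g := by
    have := add_mem (hφ (ψ g)) (hψ g)
    rwa [sub_add_sub_cancel] at this
  inv_mem' {φ} hφ g := by
    have := neg_mem (hφ (φ⁻¹ g))
    rwa [neg_sub, MulAut.apply_inv_self] at this

instance congruenceAut_normal (k : ℕ) : (congruenceAut W k).Normal where
  conj_mem φ hφ ψ g := by
    have := groupAlgebraMap_mem_pow ψ k (hφ (ψ⁻¹ g))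
    rwa [map_sub, groupAlgebraMap_of, groupAlgebraMap_of, MulAut.apply_inv_self] at this

lemma groupAlgebraMap_sub_self_mem {φ : MulAut W} (hφ : φ ∈ congruenceAut W 2) (j : ℕ)
    {a : MonoidAlgebra (ZMod 2) W} (ha : a ∈ augmentation W ^ j) :
    groupAlgebraMap φ a - a ∈ augmentation W ^ (j + 1) := by
  induction j generalizing a with
  | zero =>
    rw [pow_zero, Submodule.mem_one] at ha
    obtain ⟨c, rfl⟩ := ha
    rw [AlgHom.commutes, sub_self]
    exact zero_mem _
  | succ j ih =>
    rw [pow_succ'] at ha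
    refine Submodule.mul_induction_on ha (fun x hx y hy => ?_) (fun x y hx hy => ?_)
    · have hx2 : groupAlgebraMap φ x - x ∈ augmentation W ^ 2 := by
        induction hx using Submodule.span_induction with
        | mem x hx =>
          obtain ⟨g, rfl⟩ := hx
          rw [map_sub, groupAlgebraMap_of, map_one, sub_sub_sub_cancel_right]
          exact hφ g
        | zero => simp
        | add x y _ _ hx hy => rw [map_add, add_sub_add_comm]; exact add_mem hx hy
        | smul c x _ hx => rw [map_smul, ← smul_sub]; exact Submodule.smul_mem _ _ hx
      have : groupAlgebraMap φ (x * y) - x * y =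
          (groupAlgebraMap φ x - x) * groupAlgebraMap φ y + x * (groupAlgebraMap φ y - y) := by
        rw [map_mul]; noncomm_ring
      rw [this]
      refine add_mem ?_ ?_
      · rw [show j + 1 + 1 = 2 + j by omega, pow_add]
        exact Submodule.mul_mem_mul hx2 (groupAlgebraMap_mem_pow φ j hy)
      · rw [pow_succ' _ (j + 1)]
        exact Submodule.mul_mem_mul hx (ih hy)
    · rw [map_add, add_sub_add_comm]; exact add_mem hx hy

lemma pow_two_pow_mem_congruenceAut {φ : MulAut W} (hφ : φ ∈ congruenceAut W 2) (s : ℕ) :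
    φ ^ 2 ^ s ∈ congruenceAut W (2 ^ s + 1) := by
  intro g
  let Φ : Module.End (ZMod 2) (MonoidAlgebra (ZMod 2) W) := (groupAlgebraMap φ).toLinearMap
  have hmem : ∀ n : ℕ, ((Φ - 1) ^ n) (MonoidAlgebra.of (ZMod 2) W g - 1) ∈
      augmentation W ^ (n + 1) := by
    intro n
    induction n with
    | zero => simpa using of_sub_one_mem_augmentation g
    | succ n ih =>
      rw [pow_succ' (Φ - 1), Module.End.mul_apply]
      exact groupAlgebraMap_sub_self_mem hφ _ ih
  have : CharP (Module.End (ZMod 2) (MonoidAlgebra (ZMod 2) W)) 2 :=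
    charP_of_injective_algebraMap (algebraMap (ZMod 2) _).injective 2
  have h := hmem (2 ^ s)
  rw [sub_pow_char_pow_of_commute 2 s (Commute.one_right Φ), one_pow, ← groupAlgebraMap_pow] at h
  rw [LinearMap.sub_apply, AlgHom.toLinearMap_apply, Module.End.one_apply, map_sub,
    groupAlgebraMap_of, map_one, sub_sub_sub_cancel_right] at h
  exact h

/-- The second mod-two dimension subgroup. -/
def dimensionSubgroup (W : Type*) [Group W] : Subgroup W where
  carrier := {g | MonoidAlgebra.of (ZMod 2) W g - 1 ∈ augmentation W ^ 2}
  one_mem' := by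
    change MonoidAlgebra.of (ZMod 2) W 1 - 1 ∈ augmentation W ^ 2
    rw [map_one, sub_self]
    exact zero_mem _
  mul_mem' {g h} hg hh := by
    change MonoidAlgebra.of (ZMod 2) W (g * h) - 1 ∈ augmentation W ^ 2
    have : MonoidAlgebra.of (ZMod 2) W (g * h) - 1 =
        MonoidAlgebra.of (ZMod 2) W g * (MonoidAlgebra.of (ZMod 2) W h - 1) +
          (MonoidAlgebra.of (ZMod 2) W g - 1) := by
      rw [map_mul]; noncomm_ring
    exact this ▸ add_mem (of_mul_mem_augmentation_sq g hh) hg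
  inv_mem' {g} hg := by
    have h := neg_mem (of_mul_mem_augmentation_sq g⁻¹ hg)
    rwa [mul_sub, mul_one, ← map_mul, inv_mul_cancel, map_one, neg_sub] at h

lemma mul_self_mem_dimensionSubgroup (g : W) : g * g ∈ dimensionSubgroup W := by
  have : MonoidAlgebra.of (ZMod 2) W (g * g) - 1 =
      (MonoidAlgebra.of (ZMod 2) W g - 1) * (MonoidAlgebra.of (ZMod 2) W g - 1) +
        (2 : ZMod 2) • (MonoidAlgebra.of (ZMod 2) W g - 1) := by
    rw [map_mul, two_smul]; noncomm_ring
  change _ ∈ augmentation W ^ 2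
  rw [this, show (2 : ZMod 2) = 0 from rfl, zero_smul, add_zero, sq]
  exact Submodule.mul_mem_mul (of_sub_one_mem_augmentation g) (of_sub_one_mem_augmentation g)

instance dimensionSubgroup_normal : (dimensionSubgroup W).Normal where
  conj_mem g hg h := by
    have := groupAlgebraMap_mem_pow (MulAut.conj h) 2 hg
    rwa [map_sub, groupAlgebraMap_of, map_one] at this

lemma quotient_dimensionSubgroup_mul_self (x : W ⧸ dimensionSubgroup W) : x * x = 1 := by
  obtain ⟨g, rfl⟩ := QuotientGroup.mk_surjective x
  rw [← QuotientGroup.mk_mul, QuotientGroup.eq_one_iff]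
  exact mul_self_mem_dimensionSubgroup g

lemma finite_quotient_dimensionSubgroup [Group.FG W] : Finite (W ⧸ dimensionSubgroup W) := by
  let _ : CommGroup (W ⧸ dimensionSubgroup W) :=
    { (inferInstance : Group (W ⧸ dimensionSubgroup W)) with
      mul_comm := fun a b => by
        have inv_eq : ∀ x : W ⧸ dimensionSubgroup W, x⁻¹ = x := fun x =>
          inv_eq_of_mul_eq_one_right (quotient_dimensionSubgroup_mul_self x)
        rw [← inv_eq (a * b), mul_inv_rev, inv_eq, inv_eq] }
  refine CommGroup.finite_of_fg_isMulTorsion _ fun x => ?_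
  exact isOfFinOrder_iff_pow_eq_one.2
    ⟨2, two_pos, by rw [sq]; exact quotient_dimensionSubgroup_mul_self x⟩

end GroupAlgebra

/-- The action of `Aut(W)` by precomposition on homomorphisms out of `W`. -/
def autActHom (W E : Type*) [Group W] [Group E] : MulAut W →* Equiv.Perm (W →* E) where
  toFun φ :=
    { toFun := fun f => f.comp (φ⁻¹ : MulAut W).toMonoidHom
      invFun := fun f => f.comp φ.toMonoidHom
      left_inv := fun f => by ext; simp
      right_inv := fun f => by ext; simp }
  map_one' := by ext; simp
  map_mul' φ ψ := by ext; simp [mul_inv_rev]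

lemma map_apply_eq_of_autActHom_eq_one {W E : Type*} [Group W] [Group E] {φ : MulAut W}
    (h : autActHom W E φ = 1) (f : W →* E) (g : W) : f (φ g) = f g := by
  have := DFunLike.congr_fun (Equiv.congr_fun h f) (φ g)
  simpa [autActHom] using this.symm

lemma finite_monoidHom (W E : Type*) [Group W] [Group.FG W] [Group E] [Finite E] :
    Finite (W →* E) := by
  obtain ⟨S, hS, hfin⟩ := Group.fg_iff.1 ‹Group.FG W›
  have := hfin.to_subtype
  refine Finite.of_injective (fun (f : W →* E) (s : S) => f s) fun f f' h => ?_
  exact MonoidHom.eq_of_eqOn_dense hS fun s hs => congr_fun h ⟨s, hs⟩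

lemma exists_pow_mem_congruenceAut_two (W : Type*) [Group W] [Group.FG W] :
    ∃ m : ℕ, 0 < m ∧ ∀ φ : MulAut W, φ ^ m ∈ congruenceAut W 2 := by
  have := finite_quotient_dimensionSubgroup (W := W)
  have := finite_monoidHom W (W ⧸ dimensionSubgroup W)
  refine ⟨Nat.card (Equiv.Perm (W →* W ⧸ dimensionSubgroup W)), Nat.card_pos, fun φ g => ?_⟩
  set ψ := φ ^ Nat.card (Equiv.Perm (W →* W ⧸ dimensionSubgroup W)) with hψ
  have h1 : autActHom W (W ⧸ dimensionSubgroup W) ψ = 1 := by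
    rw [hψ, map_pow, pow_card_eq_one']
  have h2 := map_apply_eq_of_autActHom_eq_one h1 (QuotientGroup.mk' _) g
  have h3 : g⁻¹ * ψ g ∈ dimensionSubgroup W := QuotientGroup.eq.1 h2.symm
  have h4 := of_mul_mem_augmentation_sq g h3
  rwa [mul_sub, ← map_mul, mul_inv_cancel_left, mul_one] at h4

/-- A subset of a group is boundedly generated if it is contained in a product of finitely many
cyclic subgroups. -/
def BoundedlyGeneratedSet {G : Type*} [Group G] (S : Set G) : Prop :=
  ∃ l : List G, ∀ g ∈ S, ∃ m : List ℤ, m.length = l.length ∧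
    g = (List.zipWith (fun x (k : ℤ) => x ^ k) l m).prod

lemma finite_zpow_products {Q : Type*} [Group Q] {e : ℕ} (he : 0 < e) (hQ : ∀ x : Q, x ^ e = 1)
    (l : List Q) : ∃ S : Finset Q, S.card ≤ e ^ l.length ∧
      ∀ m : List ℤ, (List.zipWith (fun x (k : ℤ) => x ^ k) l m).prod ∈ S := by
  classical
  induction l with
  | nil => exact ⟨{1}, by simp⟩
  | cons x l ih =>
    obtain ⟨S, hS, hmem⟩ := ih
    refine ⟨Finset.image₂ (fun (i : ℕ) y => x ^ i * y) (Finset.range e) (insert 1 S), ?_, ?_⟩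
    · refine (Finset.card_image₂_le _ _ _).trans ?_
      have h1 : (1 : Q) ∈ S := by simpa using hmem []
      rw [Finset.card_range, Finset.insert_eq_of_mem h1, List.length_cons, pow_succ']
      exact Nat.mul_le_mul_left _ hS
    · intro m
      rw [Finset.mem_image₂]
      cases m with
      | nil => exact ⟨0, by simpa using he, 1, by simp, by simp⟩
      | cons k m =>
        have hpos : (0 : ℤ) < e := by exact_mod_cast he
        refine ⟨(k % e).toNat, ?_, _, Finset.mem_insert_of_mem (hmem m), ?_⟩
        · rw [Finset.mem_range]
          have := Int.emod_lt_of_pos k hpos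
          omega
        · have h0 := Int.emod_nonneg k hpos.ne'
          rw [List.zipWith_cons_cons, List.prod_cons, ← zpow_natCast, Int.toNat_of_nonneg h0]
          congr 1
          conv_rhs => rw [← Int.mul_ediv_add_emod k e, zpow_add, zpow_mul, zpow_natCast, hQ,
            one_zpow, one_mul]

lemma BoundedlyGenerated.exists_card_quotient_le {G : Type*} [Group G]
    (hG : BoundedlyGenerated G) :
    ∃ n : ℕ, ∀ (N : Subgroup G) [N.Normal] (e : ℕ), 0 < e → (∀ g : G, g ^ e ∈ N) →
      Finite (G ⧸ N) ∧ Nat.card (G ⧸ N) ≤ e ^ n := by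
  obtain ⟨l, hl⟩ := hG
  refine ⟨l.length, fun N _ e he hN => ?_⟩
  have hQ : ∀ x : G ⧸ N, x ^ e = 1 := fun x => by
    obtain ⟨g, rfl⟩ := QuotientGroup.mk_surjective x
    rw [← QuotientGroup.mk_pow, QuotientGroup.eq_one_iff]
    exact hN g
  obtain ⟨S, hS, hmem⟩ := finite_zpow_products he hQ (l.map (QuotientGroup.mk' N))
  have huniv : ∀ x : G ⧸ N, x ∈ S := fun x => by
    obtain ⟨g, rfl⟩ := QuotientGroup.mk_surjective x
    obtain ⟨m, -, hm⟩ := hl g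
    have : ((g : G) : G ⧸ N) = (List.zipWith (fun x (k : ℤ) => x ^ k)
        (l.map (QuotientGroup.mk' N)) m).prod := by
      conv_lhs => rw [hm]
      rw [← QuotientGroup.mk'_apply, map_list_prod, List.map_zipWith, List.zipWith_map_left]
      simp
    exact this ▸ hmem m
  rw [List.length_map] at hS
  refine ⟨Finite.of_injective (fun x : G ⧸ N => (⟨x, huniv x⟩ : S))
    fun x y h => congrArg Subtype.val h, le_trans ?_ hS⟩
  simpa using Nat.card_le_card_of_injective (fun x : G ⧸ N => (⟨x, huniv x⟩ : S))
    fun x y h => congrArg Subtype.val h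

/-- The canonical generator of the right-angled Coxeter group at a vertex. -/
def RACG.of {V : Type*} (Γ : SimpleGraph V) (v : V) : RACG Γ :=
  PresentedGroup.of v

lemma RACG.lift_relators {V : Type*} {Γ : SimpleGraph V} {G : Type*} [Group G] {f : V → G}
    (hsq : ∀ v, f v * f v = 1) (hadj : ∀ u v, Γ.Adj u v → (f u * f v) ^ 2 = 1) :
    ∀ r ∈ racgRels Γ, FreeGroup.lift f r = 1 := by
  rintro r (⟨v, rfl⟩ | ⟨u, v, h, rfl⟩)
  · simpa using hsq v
  · simpa using hadj u v h

/-- The universal property of the right-angled Coxeter group. -/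
def RACG.lift {V : Type*} {Γ : SimpleGraph V} {G : Type*} [Group G] (f : V → G)
    (hsq : ∀ v, f v * f v = 1) (hadj : ∀ u v, Γ.Adj u v → (f u * f v) ^ 2 = 1) : RACG Γ →* G :=
  PresentedGroup.toGroup (RACG.lift_relators hsq hadj)

lemma RACG.lift_of {V : Type*} {Γ : SimpleGraph V} {G : Type*} [Group G] {f : V → G}
    (hsq : ∀ v, f v * f v = 1) (hadj : ∀ u v, Γ.Adj u v → (f u * f v) ^ 2 = 1) (v : V) :
    RACG.lift f hsq hadj (RACG.of Γ v) = f v :=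
  PresentedGroup.toGroup.of _

lemma RACG.hom_ext {V : Type*} {Γ : SimpleGraph V} {G : Type*} [Group G] {f f' : RACG Γ →* G}
    (h : ∀ v, f (RACG.of Γ v) = f' (RACG.of Γ v)) : f = f' :=
  PresentedGroup.ext h

lemma RACG.closure_range_of {V : Type*} (Γ : SimpleGraph V) :
    Subgroup.closure (Set.range (RACG.of Γ)) = ⊤ :=
  PresentedGroup.closure_range_of _

instance RACG.fg {V : Type*} [Finite V] (Γ : SimpleGraph V) : Group.FG (RACG Γ) :=
  Group.fg_iff.2 ⟨_, RACG.closure_range_of Γ, Set.finite_range _⟩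

lemma RACG.of_mul_self {V : Type*} (Γ : SimpleGraph V) (v : V) :
    RACG.of Γ v * RACG.of Γ v = 1 :=
  PresentedGroup.one_of_mem (rels := racgRels Γ) (Or.inl ⟨v, rfl⟩)

lemma RACG.of_mul_of_pow_two {V : Type*} {Γ : SimpleGraph V} {u v : V} (h : Γ.Adj u v) :
    (RACG.of Γ u * RACG.of Γ v) ^ 2 = 1 :=
  PresentedGroup.one_of_mem (rels := racgRels Γ) (Or.inr ⟨u, v, h, rfl⟩)

open Polynomial in
/-- A lower unipotent matrix over the polynomial ring. -/
noncomputable def lowerUnipotent : Matrix.SpecialLinearGroup (Fin 2) (ZMod 2)[X] :=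
  ⟨!![1, 0; X, 1], by simp [Matrix.det_fin_two]⟩

open Polynomial in
/-- An upper unipotent matrix over the polynomial ring. -/
noncomputable def upperUnipotent (i : ℕ) : Matrix.SpecialLinearGroup (Fin 2) (ZMod 2)[X] :=
  ⟨!![1, X ^ i; 0, 1], by simp [Matrix.det_fin_two]⟩

lemma coe_lowerUnipotent : lowerUnipotent.1 = !![1, 0; Polynomial.X, 1] := rfl

lemma coe_upperUnipotent (i : ℕ) : (upperUnipotent i).1 = !![1, Polynomial.X ^ i; 0, 1] := rfl

lemma lowerUnipotent_mul_self : lowerUnipotent * lowerUnipotent = 1 := by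
  refine Subtype.ext ?_
  rw [Matrix.SpecialLinearGroup.coe_mul, coe_lowerUnipotent]
  simp [Matrix.one_fin_two, CharTwo.add_self_eq_zero]

lemma upperUnipotent_mul_self (i : ℕ) : upperUnipotent i * upperUnipotent i = 1 := by
  refine Subtype.ext ?_
  rw [Matrix.SpecialLinearGroup.coe_mul, coe_upperUnipotent, Matrix.SpecialLinearGroup.coe_one]
  ext1 i j
  fin_cases i <;> fin_cases j <;>
    simp [Matrix.mul_apply, Fin.sum_univ_two, CharTwo.add_self_eq_zero]

lemma upperUnipotent_commute (i j : ℕ) :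
    upperUnipotent i * upperUnipotent j = upperUnipotent j * upperUnipotent i := by
  refine Subtype.ext ?_
  rw [Matrix.SpecialLinearGroup.coe_mul, Matrix.SpecialLinearGroup.coe_mul, coe_upperUnipotent,
    coe_upperUnipotent]
  simp [add_comm]

lemma mul_pow_two_eq_one_of_commute {G : Type*} [Group G] {a b : G} (ha : a * a = 1)
    (hb : b * b = 1) (h : a * b = b * a) : (a * b) ^ 2 = 1 := by
  rw [sq, mul_assoc, ← mul_assoc b, ← h, mul_assoc, hb, mul_one, ha]

open Polynomial in
lemma X_pow_dvd_of_mem_augmentation_pow {W : Type*} [Group W]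
    (ρ : W →* Matrix (Fin 2) (Fin 2) (ZMod 2)[X]) (hρ : ∀ g i j, X ∣ (ρ g - 1) i j) (k : ℕ)
    {a : MonoidAlgebra (ZMod 2) W} (ha : a ∈ augmentation W ^ k) (i j : Fin 2) :
    X ^ k ∣ MonoidAlgebra.lift (ZMod 2) _ W ρ a i j := by
  induction k generalizing a i j with
  | zero => simp
  | succ k ih =>
    rw [pow_succ'] at ha
    refine Submodule.mul_induction_on ha (fun x hx y hy => ?_) (fun x y hx hy => ?_)
    · have hX : ∀ i j, X ∣ MonoidAlgebra.lift (ZMod 2) _ W ρ x i j := by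
        intro i j
        induction hx using Submodule.span_induction with
        | mem x hx =>
          obtain ⟨g, rfl⟩ := hx
          rw [map_sub, map_one, MonoidAlgebra.lift_of]
          exact hρ g i j
        | zero => simp
        | add x y _ _ hx hy => rw [map_add]; exact dvd_add hx hy
        | smul c x _ hx =>
          rw [map_smul, Matrix.smul_apply, Polynomial.smul_eq_C_mul]
          exact hx.mul_left _
      rw [map_mul, Matrix.mul_apply, pow_succ']
      exact Finset.dvd_sum fun l _ => mul_dvd_mul (hX i l) (ih hy l j)
    · rw [map_add]; exact dvd_add hx hy

open Polynomial in
/-- The second column of the matrix attached to a positive word. -/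
noncomputable def wordColumn : List Bool → (ZMod 2)[X] × (ZMod 2)[X]
  | [] => (0, 1)
  | b :: l =>
    ((wordColumn l).1 + X ^ (bif b then 1 else 2) * ((wordColumn l).2 + X * (wordColumn l).1),
      (wordColumn l).2 + X * (wordColumn l).1)

lemma wordColumn_intermediate {p : Polynomial (ZMod 2) × Polynomial (ZMod 2)} (h0 : p.2 ≠ 0)
    (h : p.1 = 0 ∨ p.2.natDegree < p.1.natDegree) :
    p.2 + Polynomial.X * p.1 ≠ 0 ∧ p.1.natDegree ≤ (p.2 + Polynomial.X * p.1).natDegree := by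
  rcases eq_or_ne p.1 0 with h1 | h1
  · simpa [h1] using h0
  · have hlt := h.resolve_left h1
    have hX : (Polynomial.X * p.1).natDegree = p.1.natDegree + 1 := Polynomial.natDegree_X_mul h1
    have hdeg : (p.2 + Polynomial.X * p.1).natDegree = p.1.natDegree + 1 := by
      rw [Polynomial.natDegree_add_eq_right_of_natDegree_lt (by omega), hX]
    refine ⟨fun hz => ?_, by omega⟩
    rw [hz] at hdeg
    simp at hdeg

lemma wordColumn_natDegree_step {p q : Polynomial (ZMod 2)} (hq : q ≠ 0)
    (h : p.natDegree ≤ q.natDegree) {i : ℕ} (hi : 0 < i) :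
    (p + Polynomial.X ^ i * q).natDegree = q.natDegree + i := by
  have hX : (Polynomial.X ^ i * q).natDegree = q.natDegree + i :=
    Polynomial.natDegree_X_pow_mul i hq
  rw [Polynomial.natDegree_add_eq_right_of_natDegree_lt (by omega), hX]

lemma wordColumn_invariant (l : List Bool) : (wordColumn l).2 ≠ 0 ∧
    ((wordColumn l).1 = 0 ∨ (wordColumn l).2.natDegree < (wordColumn l).1.natDegree) := by
  induction l with
  | nil => simp [wordColumn]
  | cons b l ih =>
    obtain ⟨h1, h2⟩ := wordColumn_intermediate ih.1 ih.2
    refine ⟨h1, Or.inr ?_⟩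
    have := wordColumn_natDegree_step h1 h2 (i := bif b then 1 else 2) (by cases b <;> simp)
    simp only [wordColumn]
    rw [this]
    cases b <;> simp

lemma wordColumn_natDegree_cons (b : Bool) (l : List Bool) :
    (wordColumn (b :: l)).1.natDegree =
      (wordColumn (b :: l)).2.natDegree + (bif b then 1 else 2) := by
  obtain ⟨h1, h2⟩ := wordColumn_intermediate (wordColumn_invariant l).1 (wordColumn_invariant l).2
  exact wordColumn_natDegree_step h1 h2 (by cases b <;> simp)

lemma wordColumn_injective {l l' : List Bool} (hlen : l.length = l'.length)
    (h : wordColumn l = wordColumn l') : l = l' := by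
  induction l generalizing l' with
  | nil => exact (List.length_eq_zero_iff.1 hlen.symm).symm
  | cons b l ih =>
    cases l' with
    | nil => simp at hlen
    | cons b' l' =>
      have hb : b = b' := by
        have h1 := wordColumn_natDegree_cons b l
        have h2 := wordColumn_natDegree_cons b' l'
        rw [h] at h1
        cases b <;> cases b' <;> simp at h1 h2 ⊢ <;> omega
      subst hb
      have h2 : (wordColumn l).2 + Polynomial.X * (wordColumn l).1 =
          (wordColumn l').2 + Polynomial.X * (wordColumn l').1 := congrArg Prod.snd h
      have h1 := congrArg Prod.fst h
      simp only [wordColumn] at h1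
      rw [h2] at h1
      have h3 := add_right_cancel h1
      rw [h3] at h2
      rw [ih (by simpa using hlen) (Prod.ext h3 (add_right_cancel h2))]

lemma wordColumn_natDegree_le (l : List Bool) :
    (wordColumn l).1.natDegree ≤ 3 * l.length ∧ (wordColumn l).2.natDegree ≤ 3 * l.length := by
  induction l with
  | nil => simp [wordColumn]
  | cons b l ih =>
    have h1 := wordColumn_natDegree_cons b l
    have h2 : (wordColumn (b :: l)).2.natDegree ≤ 3 * l.length + 1 := by
      simp only [wordColumn]
      refine (Polynomial.natDegree_add_le _ _).trans (max_le (by omega) ?_)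
      refine Polynomial.natDegree_mul_le.trans ?_
      rw [Polynomial.natDegree_X]
      omega
    have h3 : (bif b then 1 else 2) ≤ 2 := by cases b <;> simp
    rw [List.length_cons]
    omega

/-- The group element attached to a positive word in `a * c` and `b * c`. -/
def wordElement {W : Type*} [Group W] (a b c : W) : List Bool → W
  | [] => 1
  | i :: l => (bif i then a else b) * (c * wordElement a b c l)

lemma wordElement_column {W : Type*} [Group W] {a b c : W}
    (ρ : W →* Matrix.SpecialLinearGroup (Fin 2) (Polynomial (ZMod 2)))
    (ha : ρ a = upperUnipotent 1) (hb : ρ b = upperUnipotent 2) (hc : ρ c = lowerUnipotent)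
    (l : List Bool) : (ρ (wordElement a b c l)).1 0 1 = (wordColumn l).1 ∧
      (ρ (wordElement a b c l)).1 1 1 = (wordColumn l).2 := by
  induction l with
  | nil => simp [wordElement, wordColumn]
  | cons i l ih =>
    have hi : ρ (bif i then a else b) = upperUnipotent (bif i then 1 else 2) := by
      cases i <;> simp [ha, hb]
    simp only [wordElement, wordColumn, map_mul, hi, hc, ← ih.1, ← ih.2]
    simp only [Matrix.SpecialLinearGroup.coe_mul, Matrix.mul_apply, Fin.sum_univ_two,
      coe_upperUnipotent, coe_lowerUnipotent, Matrix.of_apply, Matrix.cons_val', Matrix.cons_val_zero,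
      Matrix.cons_val_one, Matrix.cons_val_fin_one]
    constructor <;> ring

lemma conj_lowerUnipotent_apply (g : Matrix.SpecialLinearGroup (Fin 2) (Polynomial (ZMod 2))) :
    (g * lowerUnipotent * g⁻¹).1 0 1 = Polynomial.X * g.1 0 1 ^ 2 ∧
      (g * lowerUnipotent * g⁻¹).1 1 0 = Polynomial.X * g.1 1 1 ^ 2 := by
  have hinv : (g⁻¹).1 = !![g.1 1 1, -g.1 0 1; -g.1 1 0, g.1 0 0] := by
    rw [Matrix.SpecialLinearGroup.coe_inv, Matrix.adjugate_fin_two]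
  simp only [Matrix.SpecialLinearGroup.coe_mul, Matrix.mul_apply, Fin.sum_univ_two,
    coe_lowerUnipotent, hinv, Matrix.of_apply, Matrix.cons_val', Matrix.cons_val_zero,
    Matrix.cons_val_one,
    Matrix.cons_val_fin_one]
  have h2 : (2 : Polynomial (ZMod 2)) = 0 := CharTwo.two_eq_zero
  constructor
  · linear_combination (-Polynomial.X * g.1 0 1 ^ 2) * h2
  · ring

lemma eq_of_X_pow_dvd {p q : Polynomial (ZMod 2)} {d k : ℕ} (hp : p.natDegree ≤ d)
    (hq : q.natDegree ≤ d) (hk : 2 * d + 1 < k)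
    (h : Polynomial.X ^ k ∣ Polynomial.X * p ^ 2 - Polynomial.X * q ^ 2) : p = q := by
  have hsq : Polynomial.X * p ^ 2 - Polynomial.X * q ^ 2 = Polynomial.X * (p - q) ^ 2 := by
    have h2 : (2 : Polynomial (ZMod 2)) = 0 := CharTwo.two_eq_zero
    linear_combination (Polynomial.X * p * q - Polynomial.X * q ^ 2) * h2
  rw [hsq] at h
  by_contra hne
  have h0 : p - q ≠ 0 := sub_ne_zero.2 hne
  have hd := Polynomial.natDegree_le_of_dvd h (mul_ne_zero Polynomial.X_ne_zero (pow_ne_zero 2 h0))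
  rw [Polynomial.natDegree_X_pow, Polynomial.natDegree_X_mul (pow_ne_zero 2 h0),
    Polynomial.natDegree_pow] at hd
  have := Polynomial.natDegree_sub_le p q
  have := max_le hp hq
  omega

lemma two_pow_le_card_quotient_congruenceAut {W : Type*} [Group W] {a b c : W}
    (ρ : W →* Matrix.SpecialLinearGroup (Fin 2) (Polynomial (ZMod 2)))
    (hρ : ∀ g i j, Polynomial.X ∣ ((ρ g).1 - 1) i j)
    (ha : ρ a = upperUnipotent 1) (hb : ρ b = upperUnipotent 2) (hc : ρ c = lowerUnipotent)
    {r k : ℕ} (hk : 6 * r + 1 < k) [Finite (MulAut W ⧸ congruenceAut W k)] :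
    2 ^ r ≤ Nat.card (MulAut W ⧸ congruenceAut W k) := by
  let ρ' : W →* Matrix (Fin 2) (Fin 2) (Polynomial (ZMod 2)) :=
    { toFun := fun g => (ρ g).1
      map_one' := by simp
      map_mul' := fun g h => by simp }
  let F : List.Vector Bool r → MulAut W ⧸ congruenceAut W k :=
    fun l => (MulAut.conj (wordElement a b c l.1) : MulAut W)
  have hF : Function.Injective F := by
    intro l l' h
    have h1 : (MulAut.conj (wordElement a b c l.1))⁻¹ * MulAut.conj (wordElement a b c l'.1) ∈
      congruenceAut W k := QuotientGroup.eq.1 h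
    have h2 := (congruenceAut_normal k).conj_mem _ h1 (MulAut.conj (wordElement a b c l.1))
    rw [mul_inv_cancel_left] at h2
    have h3 := h2 (MulAut.conj (wordElement a b c l.1) c)
    rw [MulAut.mul_apply, MulAut.inv_apply_self, MulAut.conj_apply, MulAut.conj_apply] at h3
    have h4 := X_pow_dvd_of_mem_augmentation_pow ρ' hρ k h3
    simp only [map_sub, MonoidAlgebra.lift_of, Matrix.sub_apply] at h4
    have key : ∀ w, ρ' (w * c * w⁻¹) = (ρ w * lowerUnipotent * (ρ w)⁻¹).1 := fun w => by
      change (ρ (w * c * w⁻¹)).1 = _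
      rw [map_mul, map_mul, map_inv, hc]
    simp only [key] at h4
    have h01 := h4 0 1
    have h10 := h4 1 0
    simp only [(conj_lowerUnipotent_apply _).1, (wordElement_column ρ ha hb hc _).1] at h01
    simp only [(conj_lowerUnipotent_apply _).2, (wordElement_column ρ ha hb hc _).2] at h10
    have hd := wordColumn_natDegree_le l.1
    have hd' := wordColumn_natDegree_le l'.1
    rw [l.2] at hd
    rw [l'.2] at hd'
    exact Subtype.ext (wordColumn_injective (l.2.trans l'.2.symm) (Prod.ext
      (eq_of_X_pow_dvd hd'.1 hd.1 (by omega) h01).symm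
      (eq_of_X_pow_dvd hd'.2 hd.2 (by omega) h10).symm))
  have := Nat.card_le_card_of_injective F hF
  rwa [Nat.card_eq_fintype_card, card_vector, Fintype.card_bool] at this

lemma exists_mul_lt_two_pow (m n : ℕ) : ∃ j : ℕ, (m + j + 3) * n < 2 ^ j := by
  refine ⟨2 * (m + n + 5), ?_⟩
  have h : m + n + 6 ≤ 2 ^ (m + n + 5) := Nat.lt_two_pow_self
  have h1 : (m + n + 5) * 4 ≤ 2 ^ (m + n + 5) := by
    have h2 : m + n + 2 < 2 ^ (m + n + 2) := Nat.lt_two_pow_self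
    have h3 : 2 ^ (m + n + 5) = 2 ^ (m + n + 2) * 8 :=
      pow_add 2 (m + n + 2) 3
    omega
  rw [two_mul (m + n + 5), pow_add]
  nlinarith [Nat.mul_le_mul h1 h]

/-- A finitely generated group with a suitable representation over `𝔽₂[X]` has an automorphism
group that is not boundedly generated: its congruence quotients grow too fast. -/
lemma not_boundedlyGenerated_mulAut {W : Type*} [Group W] [Group.FG W] {a b c : W}
    (ρ : W →* Matrix.SpecialLinearGroup (Fin 2) (Polynomial (ZMod 2)))
    (hρ : ∀ g i j, Polynomial.X ∣ ((ρ g).1 - 1) i j)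
    (ha : ρ a = upperUnipotent 1) (hb : ρ b = upperUnipotent 2) (hc : ρ c = lowerUnipotent) :
    ¬BoundedlyGenerated (MulAut W) := by
  intro hG
  obtain ⟨n, hn⟩ := hG.exists_card_quotient_le
  obtain ⟨m, hm, hpow⟩ := exists_pow_mem_congruenceAut_two W
  obtain ⟨j, hj⟩ := exists_mul_lt_two_pow m n
  obtain ⟨hfin, hle⟩ := hn (congruenceAut W (2 ^ (j + 3) + 1)) (m * 2 ^ (j + 3)) (by positivity)
    fun φ => by rw [pow_mul]; exact pow_two_pow_mem_congruenceAut (hpow φ) _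
  have hk : 6 * 2 ^ j + 1 < 2 ^ (j + 3) + 1 := by
    have : 0 < 2 ^ j := by positivity
    rw [pow_add]
    omega
  have h1 := (two_pow_le_card_quotient_congruenceAut ρ hρ ha hb hc hk).trans hle
  have h2 : (m * 2 ^ (j + 3)) ^ n ≤ 2 ^ ((m + j + 3) * n) := by
    rw [pow_mul, add_assoc m, pow_add 2 m]
    exact Nat.pow_le_pow_left (Nat.mul_le_mul_right _ Nat.lt_two_pow_self.le) n
  exact absurd (h1.trans h2) (not_le.2 (Nat.pow_lt_pow_right one_lt_two hj))

lemma map_constantCoeff_lowerUnipotent :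
    Matrix.SpecialLinearGroup.map (Polynomial.constantCoeff (R := ZMod 2)) lowerUnipotent = 1 := by
  refine Subtype.ext ?_
  rw [Matrix.SpecialLinearGroup.map_apply_coe, coe_lowerUnipotent,
    Matrix.SpecialLinearGroup.coe_one]
  ext1 i j
  fin_cases i <;> fin_cases j <;> simp

lemma map_constantCoeff_upperUnipotent {k : ℕ} (hk : k ≠ 0) :
    Matrix.SpecialLinearGroup.map (Polynomial.constantCoeff (R := ZMod 2)) (upperUnipotent k) =
      1 := by
  refine Subtype.ext ?_
  rw [Matrix.SpecialLinearGroup.map_apply_coe, coe_upperUnipotent,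
    Matrix.SpecialLinearGroup.coe_one]
  ext1 i j
  fin_cases i <;> fin_cases j <;> simp [hk.symm]

lemma X_dvd_of_map_constantCoeff_eq_one
    {A : Matrix.SpecialLinearGroup (Fin 2) (Polynomial (ZMod 2))}
    (h : Matrix.SpecialLinearGroup.map (Polynomial.constantCoeff (R := ZMod 2)) A = 1)
    (i j : Fin 2) : Polynomial.X ∣ (A.1 - 1) i j := by
  have h1 : (A.1 i j).coeff 0 = (1 : Matrix (Fin 2) (Fin 2) (ZMod 2)) i j := by
    have h2 := congrArg Subtype.val h
    rw [Matrix.SpecialLinearGroup.map_apply_coe, Matrix.SpecialLinearGroup.coe_one] at h2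
    rw [← h2]
    rfl
  rw [Polynomial.X_dvd_iff, Matrix.sub_apply, Polynomial.coeff_sub, h1]
  rcases eq_or_ne i j with rfl | hij
  · rw [Matrix.one_apply_eq, Matrix.one_apply_eq, Polynomial.coeff_one_zero, sub_self]
  · rw [Matrix.one_apply_ne hij, Matrix.one_apply_ne hij, Polynomial.coeff_zero, sub_self]

lemma three_vertex_commute {V G : Type*} [DecidableEq V] [Group G] {Γ : SimpleGraph V}
    {u v w : V} (huv : ¬Γ.Adj u v) (huw : ¬Γ.Adj u w) {r p q : G} (h : p * q = q * p) {x y : V}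
    (hxy : Γ.Adj x y) :
    (if x = u then r else if x = v then p else if x = w then q else 1) *
        (if y = u then r else if y = v then p else if y = w then q else 1) =
      (if y = u then r else if y = v then p else if y = w then q else 1) *
        (if x = u then r else if x = v then p else if x = w then q else 1) := by
  have hvu : ¬Γ.Adj v u := fun h => huv h.symm
  have hwu : ¬Γ.Adj w u := fun h => huw h.symm
  split_ifs <;> first
    | rw [mul_one, one_mul]
    | rfl
    | exact h
    | exact h.symm
    | (subst_vars; contradiction)

lemma not_boundedlyGenerated_mulAut_racg {V : Type*} [Finite V] {Γ : SimpleGraph V} {u v w : V}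
    (hvw : v ≠ w) (hvu : v ≠ u) (hwu : w ≠ u) (huv : ¬Γ.Adj u v) (huw : ¬Γ.Adj u w) :
    ¬BoundedlyGenerated (MulAut (RACG Γ)) := by
  classical
  obtain ⟨f, hf⟩ : ∃ f : V → Matrix.SpecialLinearGroup (Fin 2) (Polynomial (ZMod 2)), ∀ x, f x =
    if x = u then lowerUnipotent else if x = v then upperUnipotent 1 else
      if x = w then upperUnipotent 2 else 1 := ⟨_, fun _ => rfl⟩
  have hsq : ∀ x, f x * f x = 1 := fun x => by
    rw [hf]
    split_ifs
    exacts [lowerUnipotent_mul_self, upperUnipotent_mul_self 1, upperUnipotent_mul_self 2,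
      one_mul 1]
  have hadj : ∀ x y, Γ.Adj x y → (f x * f y) ^ 2 = 1 := fun x y hxy => by
    refine mul_pow_two_eq_one_of_commute (hsq x) (hsq y) ?_
    rw [hf, hf]
    exact three_vertex_commute huv huw (upperUnipotent_commute 1 2) hxy
  have hmap : (Matrix.SpecialLinearGroup.map (n := Fin 2)
      (Polynomial.constantCoeff (R := ZMod 2))).comp (RACG.lift f hsq hadj) = 1 := by
    refine RACG.hom_ext fun x => ?_
    rw [MonoidHom.comp_apply, RACG.lift_of, hf, MonoidHom.one_apply]
    split_ifs
    exacts [map_constantCoeff_lowerUnipotent, map_constantCoeff_upperUnipotent one_ne_zero,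
      map_constantCoeff_upperUnipotent two_ne_zero, map_one _]
  have hdvd : ∀ g i j, Polynomial.X ∣ ((RACG.lift f hsq hadj g).1 - 1) i j := fun g i j => by
    refine X_dvd_of_map_constantCoeff_eq_one ?_ i j
    rw [← MonoidHom.comp_apply, hmap, MonoidHom.one_apply]
  refine not_boundedlyGenerated_mulAut (a := RACG.of Γ v) (b := RACG.of Γ w) (c := RACG.of Γ u)
    (RACG.lift f hsq hadj) hdvd ?_ ?_ ?_ <;>
    rw [RACG.lift_of, hf]
  · rw [if_neg hvu, if_pos rfl]
  · rw [if_neg hwu, if_neg hvw.symm, if_pos rfl]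
  · rw [if_pos rfl]

lemma zipWith_zpow_replicate_zero {G : Type*} [Group G] (l : List G) :
    (List.zipWith (fun x (k : ℤ) => x ^ k) l (List.replicate l.length 0)).prod = 1 := by
  induction l with
  | nil => simp
  | cons a l ih => simpa [List.replicate_succ] using ih

lemma BoundedlyGeneratedSet.mono {G : Type*} [Group G] {S S' : Set G}
    (h : BoundedlyGeneratedSet S') (hS : S ⊆ S') : BoundedlyGeneratedSet S :=
  let ⟨l, hl⟩ := h
  ⟨l, fun g hg => hl g (hS hg)⟩

lemma BoundedlyGeneratedSet.mul {G : Type*} [Group G] {S S' : Set G}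
    (h : BoundedlyGeneratedSet S) (h' : BoundedlyGeneratedSet S') :
    BoundedlyGeneratedSet {g | ∃ s ∈ S, ∃ s' ∈ S', g = s * s'} := by
  obtain ⟨l, hl⟩ := h
  obtain ⟨l', hl'⟩ := h'
  refine ⟨l ++ l', ?_⟩
  rintro g ⟨s, hs, s', hs', rfl⟩
  obtain ⟨m, hm, hsm⟩ := hl s hs
  obtain ⟨m', hm', hsm'⟩ := hl' s' hs'
  refine ⟨m ++ m', by simp [hm, hm'], ?_⟩
  rw [List.zipWith_append hm.symm, List.prod_append, ← hsm, ← hsm']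

lemma Set.Finite.boundedlyGeneratedSet {G : Type*} [Group G] {S : Set G} (hS : S.Finite) :
    BoundedlyGeneratedSet S := by
  induction S, hS using Set.Finite.induction_on with
  | empty => exact ⟨[], by simp⟩
  | @insert a s _ _ ih =>
    obtain ⟨l, hl⟩ := ih
    refine ⟨a :: l, ?_⟩
    rintro g (rfl | hg)
    · exact ⟨1 :: List.replicate l.length 0, by simp, by simp [zipWith_zpow_replicate_zero]⟩
    · obtain ⟨m, hm, hgm⟩ := hl g hg
      exact ⟨0 :: m, by simp [hm], by simpa using hgm⟩

/-- Bounded generation passes from the differences within the fibres of a map with finite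
codomain to the whole set. -/
lemma BoundedlyGeneratedSet.of_finite_fibres {G F : Type*} [Group G] [Finite F] {S X : Set G}
    (hS : BoundedlyGeneratedSet S) (f : G → F)
    (h : ∀ g ∈ X, ∀ g' ∈ X, f g = f g' → g' * g⁻¹ ∈ S) : BoundedlyGeneratedSet X := by
  have hfin : (f '' X).Finite := Set.toFinite _
  choose! rep hrep using fun y (hy : y ∈ f '' X) => hy
  refine (hS.mul (hfin.image rep).boundedlyGeneratedSet).mono fun g hg => ?_
  have hy := Set.mem_image_of_mem f hg
  exact ⟨_, h _ (hrep _ hy).1 g hg (hrep _ hy).2, _, Set.mem_image_of_mem rep hy,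
    (inv_mul_cancel_right _ _).symm⟩

lemma RACG.commute_of_adj {V : Type*} {Γ : SimpleGraph V} {u v : V} (h : Γ.Adj u v) :
    Commute (RACG.of Γ u) (RACG.of Γ v) := by
  have h1 := RACG.of_mul_of_pow_two h
  have hu := inv_eq_of_mul_eq_one_right (RACG.of_mul_self Γ u)
  have hv := inv_eq_of_mul_eq_one_right (RACG.of_mul_self Γ v)
  rw [sq] at h1
  have h2 := eq_inv_of_mul_eq_one_left h1
  rwa [mul_inv_rev, hu, hv] at h2

lemma RACG.inv_of {V : Type*} (Γ : SimpleGraph V) (v : V) : (RACG.of Γ v)⁻¹ = RACG.of Γ v :=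
  inv_eq_of_mul_eq_one_right (RACG.of_mul_self Γ v)

/-- Every vertex has at most one other vertex that is not adjacent to it. -/
def AtMostOneNonNeighbor {V : Type*} (Γ : SimpleGraph V) : Prop :=
  ∀ u v w : V, v ≠ u → w ≠ u → ¬Γ.Adj u v → ¬Γ.Adj u w → v = w

/-- The pairs of distinct non-adjacent vertices, listed in increasing order. -/
abbrev NonEdge {V : Type*} [LinearOrder V] (Γ : SimpleGraph V) :=
  {p : V × V // p.1 < p.2 ∧ ¬Γ.Adj p.1 p.2}

section NonEdge

variable {V : Type*} [LinearOrder V] {Γ : SimpleGraph V}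

lemma AtMostOneNonNeighbor.adj_of_ne (h : AtMostOneNonNeighbor Γ) (p : NonEdge Γ) {u : V}
    (h1 : u ≠ p.1.1) (h2 : u ≠ p.1.2) : Γ.Adj u p.1.1 ∧ Γ.Adj u p.1.2 := by
  constructor
  · by_contra hu
    exact h2 (h p.1.1 u p.1.2 h1 p.2.1.ne' (fun h' => hu h'.symm) p.2.2)
  · by_contra hu
    exact h1 (h p.1.2 u p.1.1 h2 p.2.1.ne (fun h' => hu h'.symm) (fun h' => p.2.2 h'.symm))

lemma AtMostOneNonNeighbor.disjoint (h : AtMostOneNonNeighbor Γ) {p q : NonEdge Γ} (hpq : p ≠ q) :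
    (p.1.1 ≠ q.1.1 ∧ p.1.1 ≠ q.1.2) ∧ (p.1.2 ≠ q.1.1 ∧ p.1.2 ≠ q.1.2) := by
  obtain ⟨⟨a, b⟩, hab, hab'⟩ := p
  obtain ⟨⟨c, d⟩, hcd, hcd'⟩ := q
  dsimp only at *
  refine ⟨⟨?_, ?_⟩, ?_, ?_⟩ <;> rintro rfl
  · exact hpq (by rw [Subtype.mk.injEq, h a b d hab.ne' hcd.ne' hab' hcd'])
  · have := h a b c hab.ne' hcd.ne hab' (fun h' => hcd' h'.symm)
    subst this
    exact lt_asymm hab hcd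
  · have := h b a d hab.ne hcd.ne' (fun h' => hab' h'.symm) hcd'
    subst this
    exact lt_asymm hab hcd
  · exact hpq (by
      rw [Subtype.mk.injEq, h b a c hab.ne hcd.ne (fun h' => hab' h'.symm) fun h' => hcd' h'.symm])

open DihedralGroup in
lemma dihedralProj_sq (p : NonEdge Γ) (v : V) :
    (if v = p.1.1 then sr 0 else if v = p.1.2 then sr 1 else 1 : DihedralGroup 0) *
      (if v = p.1.1 then sr 0 else if v = p.1.2 then sr 1 else 1) = 1 := by
  split_ifs
  exacts [sr_mul_self 0, sr_mul_self 1, mul_one 1]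

open DihedralGroup in
/-- The projection of the Coxeter group onto the infinite dihedral group spanned by a pair of
non-adjacent vertices. -/
def dihedralProj (p : NonEdge Γ) : RACG Γ →* DihedralGroup 0 :=
  RACG.lift (fun v => if v = p.1.1 then sr 0 else if v = p.1.2 then sr 1 else 1)
    (dihedralProj_sq p) fun u v huv => by
      refine mul_pow_two_eq_one_of_commute (dihedralProj_sq p u) (dihedralProj_sq p v) ?_
      split_ifs with h1 h2 h3 h4 h5 h6
      · rfl
      · exact absurd (h1 ▸ h3 ▸ huv) p.2.2
      · rw [mul_one, one_mul]
      · exact absurd (h4 ▸ h5 ▸ huv.symm) p.2.2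
      · rfl
      · rw [mul_one, one_mul]
      · rw [mul_one, one_mul]
      · rw [mul_one, one_mul]
      · rfl

lemma dihedralProj_of_fst (p : NonEdge Γ) :
    dihedralProj p (RACG.of Γ p.1.1) = DihedralGroup.sr 0 := by
  rw [dihedralProj, RACG.lift_of, if_pos rfl]

lemma dihedralProj_of_snd (p : NonEdge Γ) :
    dihedralProj p (RACG.of Γ p.1.2) = DihedralGroup.sr 1 := by
  rw [dihedralProj, RACG.lift_of, if_neg p.2.1.ne', if_pos rfl]

lemma dihedralProj_of_of_ne (p : NonEdge Γ) {u : V} (h1 : u ≠ p.1.1) (h2 : u ≠ p.1.2) :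
    dihedralProj p (RACG.of Γ u) = 1 := by
  rw [dihedralProj, RACG.lift_of, if_neg h1, if_neg h2]

/-- The translation attached to a pair of non-adjacent vertices. -/
def translation (p : NonEdge Γ) : RACG Γ := RACG.of Γ p.1.1 * RACG.of Γ p.1.2

variable (Γ) in
/-- The subgroup of translations. -/
def translationSubgroup : Subgroup (RACG Γ) :=
  Subgroup.closure (Set.range (translation (Γ := Γ)))

lemma translation_mem (p : NonEdge Γ) : translation p ∈ translationSubgroup Γ :=
  Subgroup.subset_closure ⟨p, rfl⟩

lemma inv_translation (p : NonEdge Γ) :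
    (translation p)⁻¹ = RACG.of Γ p.1.2 * RACG.of Γ p.1.1 := by
  rw [translation, mul_inv_rev, RACG.inv_of, RACG.inv_of]

lemma AtMostOneNonNeighbor.commute_translation (h : AtMostOneNonNeighbor Γ) (p q : NonEdge Γ) :
    Commute (translation p) (translation q) := by
  rcases eq_or_ne p q with rfl | hpq
  · exact Commute.refl _
  · obtain ⟨⟨h1, h2⟩, h3, h4⟩ := h.disjoint hpq
    have ha := h.adj_of_ne q h1 h2
    have hb := h.adj_of_ne q h3 h4
    exact ((RACG.commute_of_adj ha.1).mul_right (RACG.commute_of_adj ha.2)).mul_left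
      ((RACG.commute_of_adj hb.1).mul_right (RACG.commute_of_adj hb.2))

lemma AtMostOneNonNeighbor.conj_translation_mem (h : AtMostOneNonNeighbor Γ) (u : V)
    (p : NonEdge Γ) :
    RACG.of Γ u * translation p * (RACG.of Γ u)⁻¹ ∈ translationSubgroup Γ := by
  by_cases h1 : u = p.1.1
  · have : RACG.of Γ u * translation p * (RACG.of Γ u)⁻¹ = (translation p)⁻¹ := by
      rw [inv_translation, translation, RACG.inv_of, h1, ← mul_assoc, RACG.of_mul_self, one_mul]
    rw [this]
    exact inv_mem (translation_mem p)
  · by_cases h2 : u = p.1.2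
    · have : RACG.of Γ u * translation p * (RACG.of Γ u)⁻¹ = (translation p)⁻¹ := by
        rw [inv_translation, translation, h2, ← mul_assoc, mul_inv_cancel_right]
      rw [this]
      exact inv_mem (translation_mem p)
    · have ha := h.adj_of_ne p h1 h2
      have hc : Commute (RACG.of Γ u) (translation p) :=
        (RACG.commute_of_adj ha.1).mul_right (RACG.commute_of_adj ha.2)
      rw [hc.eq, mul_inv_cancel_right]
      exact translation_mem p

lemma AtMostOneNonNeighbor.normal_translationSubgroup (h : AtMostOneNonNeighbor Γ) :
    (translationSubgroup Γ).Normal := by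
  have hconj : ∀ u, ∀ g ∈ translationSubgroup Γ,
      RACG.of Γ u * g * (RACG.of Γ u)⁻¹ ∈ translationSubgroup Γ := fun u g hg => by
    have : translationSubgroup Γ ≤
        (translationSubgroup Γ).comap (MulAut.conj (RACG.of Γ u)).toMonoidHom := by
      refine (Subgroup.closure_le _).2 ?_
      rintro _ ⟨p, rfl⟩
      exact h.conj_translation_mem u p
    exact this hg
  rw [← Subgroup.normalizer_eq_top_iff, eq_top_iff, ← RACG.closure_range_of, Subgroup.closure_le]
  rintro _ ⟨u, rfl⟩
  refine Subgroup.mem_normalizer_iff.2 fun g => ⟨hconj u g, fun hg => ?_⟩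
  have := hconj u _ hg
  rwa [← mul_assoc, ← mul_assoc, RACG.of_mul_self, one_mul, RACG.inv_of, mul_assoc,
    RACG.of_mul_self, mul_one] at this

lemma finite_quotient_translationSubgroup [Finite V]
    [(translationSubgroup Γ).Normal] : Finite (RACG Γ ⧸ translationSubgroup Γ) := by
  let q := QuotientGroup.mk' (translationSubgroup Γ)
  have hq : Function.Surjective q := QuotientGroup.mk'_surjective _
  have hgen : Subgroup.closure (Set.range fun u => q (RACG.of Γ u)) = ⊤ := by
    rw [Set.range_comp' q, ← MonoidHom.map_closure, RACG.closure_range_of,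
      Subgroup.map_top_of_surjective q hq]
  have hsq : ∀ u, q (RACG.of Γ u) * q (RACG.of Γ u) = 1 := fun u => by
    rw [← map_mul, RACG.of_mul_self, map_one]
  have hpair : ∀ p : NonEdge Γ, q (RACG.of Γ p.1.1) = q (RACG.of Γ p.1.2) := fun p => by
    have h1 : q (translation p) = 1 := (QuotientGroup.eq_one_iff _).2 (translation_mem p)
    rw [translation, map_mul] at h1
    exact mul_right_cancel (h1.trans (hsq _).symm)
  have hcomm : ∀ u v, q (RACG.of Γ u) * q (RACG.of Γ v) = q (RACG.of Γ v) * q (RACG.of Γ u) := by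
    intro u v
    by_cases huv : Γ.Adj u v
    · rw [← map_mul, (RACG.commute_of_adj huv).eq, map_mul]
    · rcases lt_trichotomy u v with hlt | rfl | hlt
      · rw [hpair ⟨(u, v), hlt, huv⟩]
      · rfl
      · rw [hpair ⟨(v, u), hlt, fun h' => huv h'.symm⟩]
  have hcl : IsMulCommutative (Subgroup.closure (Set.range fun u => q (RACG.of Γ u))) := by
    refine Subgroup.isMulCommutative_closure ?_
    rintro _ ⟨u, rfl⟩ _ ⟨v, rfl⟩
    exact hcomm u v
  have hmul : ∀ x y : RACG Γ ⧸ translationSubgroup Γ, x * y = y * x := fun x y => by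
    have hx : x ∈ Subgroup.closure (Set.range fun u => q (RACG.of Γ u)) := hgen ▸ Subgroup.mem_top x
    have hy : y ∈ Subgroup.closure (Set.range fun u => q (RACG.of Γ u)) := hgen ▸ Subgroup.mem_top y
    exact congrArg Subtype.val (hcl.is_comm.comm ⟨x, hx⟩ ⟨y, hy⟩)
  let _ : CommGroup (RACG Γ ⧸ translationSubgroup Γ) := { mul_comm := hmul }
  have hfg : Group.FG (RACG Γ ⧸ translationSubgroup Γ) :=
    Group.fg_iff.2 ⟨_, hgen, Set.finite_range _⟩
  refine CommGroup.finite_of_fg_isMulTorsion _ fun x => ?_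
  have hx : x ∈ Subgroup.closure (Set.range fun u => q (RACG.of Γ u)) := hgen ▸ Subgroup.mem_top x
  refine isOfFinOrder_iff_pow_eq_one.2 ⟨2, two_pos, ?_⟩
  induction hx using Subgroup.closure_induction with
  | mem x hx =>
    obtain ⟨u, rfl⟩ := hx
    exact (sq _).trans (hsq u)
  | one => exact one_pow 2
  | mul x y _ _ hx hy => rw [mul_pow, hx, hy, one_mul]
  | inv x _ hx => rw [inv_pow, hx, inv_one]

lemma prod_map_r (l : List (NonEdge Γ)) (f : NonEdge Γ → ZMod 0) :
    (l.map fun q => DihedralGroup.r (f q)).prod = DihedralGroup.r (l.map f).sum := by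
  induction l with
  | nil => rfl
  | cons q l ih =>
    rw [List.map_cons, List.prod_cons, ih, DihedralGroup.r_mul_r, List.map_cons, List.sum_cons]

/-- The automorphisms acting trivially modulo translations. -/
def translationAut {V : Type*} [LinearOrder V] (Γ : SimpleGraph V) [(translationSubgroup Γ).Normal] :
    Subgroup (MulAut (RACG Γ)) :=
  (autActHom (RACG Γ) (RACG Γ ⧸ translationSubgroup Γ)).ker

lemma mk_apply_of_mem_translationAut [(translationSubgroup Γ).Normal] {φ : MulAut (RACG Γ)}
    (hφ : φ ∈ translationAut Γ) (g : RACG Γ) :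
    QuotientGroup.mk' (translationSubgroup Γ) (φ g) = QuotientGroup.mk' _ g :=
  map_apply_eq_of_autActHom_eq_one hφ _ g

section Fintype

variable [Fintype (NonEdge Γ)]

/-- The product of powers of the translations with the given exponents. -/
noncomputable def translationProd (a : NonEdge Γ → ℤ) : RACG Γ :=
  (Finset.univ.toList.map fun p => translation p ^ a p).prod

lemma translationProd_mem (a : NonEdge Γ → ℤ) : translationProd a ∈ translationSubgroup Γ := by
  refine list_prod_mem fun x hx => ?_
  obtain ⟨p, -, rfl⟩ := List.mem_map.1 hx
  exact zpow_mem (translation_mem p) _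

lemma AtMostOneNonNeighbor.exists_eq_translationProd (h : AtMostOneNonNeighbor Γ) {g : RACG Γ}
    (hg : g ∈ translationSubgroup Γ) : ∃ a, g = translationProd a := by
  have hcl : IsMulCommutative (translationSubgroup Γ) := by
    refine Subgroup.isMulCommutative_closure ?_
    rintro _ ⟨p, rfl⟩ _ ⟨q, rfl⟩
    exact h.commute_translation p q
  let _ : CommGroup (translationSubgroup Γ) := { mul_comm := hcl.is_comm.comm }
  let t : NonEdge Γ → translationSubgroup Γ := fun p => ⟨translation p, translation_mem p⟩
  have ht : Subgroup.closure (Set.range t) = ⊤ := by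
    refine Eq.trans (congrArg Subgroup.closure ?_)
      (Subgroup.closure_closure_coe_preimage (k := Set.range (translation (Γ := Γ))))
    ext x
    exact exists_congr fun p => Subtype.ext_iff
  obtain ⟨a, ha⟩ := Subgroup.exists_of_mem_closure_range t ⟨g, hg⟩ (ht ▸ Subgroup.mem_top _)
  refine ⟨a, ?_⟩
  rw [← Finset.prod_map_toList] at ha
  have h1 := congrArg (translationSubgroup Γ).subtype ha
  rw [map_list_prod, List.map_map] at h1
  exact h1

lemma AtMostOneNonNeighbor.dihedralProj_translationProd (h : AtMostOneNonNeighbor Γ)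
    (p : NonEdge Γ) (a : NonEdge Γ → ℤ) :
    dihedralProj p (translationProd a) = DihedralGroup.r (Int.cast (a p) : ZMod 0) := by
  have h1 : ∀ q, dihedralProj p (translation q ^ a q) =
      DihedralGroup.r (if q = p then (Int.cast (a p) : ZMod 0) else 0) := fun q => by
    rw [map_zpow, translation, map_mul]
    split_ifs with hq
    · rw [hq, dihedralProj_of_fst, dihedralProj_of_snd, DihedralGroup.sr_mul_sr,
        DihedralGroup.r_zpow, sub_zero, one_mul]
    · obtain ⟨⟨h1, h2⟩, h3, h4⟩ := h.disjoint hq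
      rw [dihedralProj_of_of_ne p h1 h2, dihedralProj_of_of_ne p h3 h4, one_mul, one_zpow,
        DihedralGroup.one_def]
  rw [translationProd, map_list_prod, List.map_map]
  simp only [Function.comp_def, h1]
  rw [prod_map_r, Finset.sum_map_toList, Finset.sum_ite_eq' Finset.univ p,
    if_pos (Finset.mem_univ p)]

lemma AtMostOneNonNeighbor.exists_dihedralProj_eq_r (h : AtMostOneNonNeighbor Γ) (p : NonEdge Γ)
    {g : RACG Γ} (hg : g ∈ translationSubgroup Γ) : ∃ i, dihedralProj p g = DihedralGroup.r i := by
  obtain ⟨a, rfl⟩ := h.exists_eq_translationProd hg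
  exact ⟨_, h.dihedralProj_translationProd p a⟩

lemma AtMostOneNonNeighbor.eq_one_of_dihedralProj (h : AtMostOneNonNeighbor Γ) {g : RACG Γ}
    (hg : g ∈ translationSubgroup Γ) (h1 : ∀ p, dihedralProj p g = 1) : g = 1 := by
  obtain ⟨a, rfl⟩ := h.exists_eq_translationProd hg
  have h0 : ∀ p, a p = 0 := fun p => by
    have := h1 p
    rw [h.dihedralProj_translationProd, DihedralGroup.one_def, DihedralGroup.r.injEq] at this
    exact this
  simp [translationProd, h0]

lemma AtMostOneNonNeighbor.boundedlyGeneratedSet_conj (h : AtMostOneNonNeighbor Γ) :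
    BoundedlyGeneratedSet (MulAut.conj '' (translationSubgroup Γ : Set (RACG Γ))) := by
  refine ⟨Finset.univ.toList.map fun p : NonEdge Γ => MulAut.conj (translation p), ?_⟩
  rintro _ ⟨g, hg, rfl⟩
  obtain ⟨a, rfl⟩ := h.exists_eq_translationProd hg
  refine ⟨Finset.univ.toList.map a, by simp, ?_⟩
  rw [translationProd, map_list_prod, List.map_map, List.zipWith_map, List.zipWith_self]
  simp [Function.comp_def]

section Automorphism

variable [(translationSubgroup Γ).Normal] {φ ψ : MulAut (RACG Γ)}

lemma AtMostOneNonNeighbor.exists_dihedralProj_apply (h : AtMostOneNonNeighbor Γ)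
    (hφ : φ ∈ translationAut Γ) (p : NonEdge Γ) (g : RACG Γ) :
    ∃ i, dihedralProj p (φ g) = dihedralProj p g * DihedralGroup.r i := by
  obtain ⟨i, hi⟩ := h.exists_dihedralProj_eq_r p
    (QuotientGroup.eq.1 (mk_apply_of_mem_translationAut hφ g).symm)
  exact ⟨i, by rw [← hi, ← map_mul, mul_inv_cancel_left]⟩

lemma AtMostOneNonNeighbor.dihedralProj_apply_of_ne (h : AtMostOneNonNeighbor Γ)
    (hφ : φ ∈ translationAut Γ) (p : NonEdge Γ) {u : V} (h1 : u ≠ p.1.1) (h2 : u ≠ p.1.2) :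
    dihedralProj p (φ (RACG.of Γ u)) = 1 := by
  obtain ⟨i, hi⟩ := h.exists_dihedralProj_apply hφ p (RACG.of Γ u)
  rw [dihedralProj_of_of_ne p h1 h2, one_mul] at hi
  have hsq : dihedralProj p (φ (RACG.of Γ u)) * dihedralProj p (φ (RACG.of Γ u)) = 1 := by
    rw [← map_mul, ← map_mul, RACG.of_mul_self, map_one, map_one]
  rw [hi, DihedralGroup.r_mul_r, DihedralGroup.one_def, DihedralGroup.r.injEq] at hsq
  have h0 : i = 0 := by
    change ℤ at i
    change (i + i : ℤ) = 0 at hsq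
    change i = (0 : ℤ)
    omega
  rw [hi, h0, DihedralGroup.one_def]

lemma AtMostOneNonNeighbor.exists_dihedralProj_fst (h : AtMostOneNonNeighbor Γ)
    (hφ : φ ∈ translationAut Γ) (p : NonEdge Γ) :
    ∃ i, dihedralProj p (φ (RACG.of Γ p.1.1)) = DihedralGroup.sr i := by
  obtain ⟨i, hi⟩ := h.exists_dihedralProj_apply hφ p (RACG.of Γ p.1.1)
  rw [dihedralProj_of_fst, DihedralGroup.sr_mul_r] at hi
  exact ⟨_, hi⟩

lemma AtMostOneNonNeighbor.exists_dihedralProj_snd (h : AtMostOneNonNeighbor Γ)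
    (hφ : φ ∈ translationAut Γ) (p : NonEdge Γ) :
    ∃ i, dihedralProj p (φ (RACG.of Γ p.1.2)) = DihedralGroup.sr i := by
  obtain ⟨i, hi⟩ := h.exists_dihedralProj_apply hφ p (RACG.of Γ p.1.2)
  rw [dihedralProj_of_snd, DihedralGroup.sr_mul_r] at hi
  exact ⟨_, hi⟩

lemma AtMostOneNonNeighbor.isUnit_sub (h : AtMostOneNonNeighbor Γ)
    (hφ : φ ∈ translationAut Γ) (p : NonEdge Γ) {a b : ZMod 0}
    (ha : dihedralProj p (φ (RACG.of Γ p.1.1)) = DihedralGroup.sr a)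
    (hb : dihedralProj p (φ (RACG.of Γ p.1.2)) = DihedralGroup.sr b) : IsUnit (b - a) := by
  have key : ∀ g : RACG Γ, ∃ i, dihedralProj p (φ g) = DihedralGroup.r ((b - a) * i) ∨
      dihedralProj p (φ g) = DihedralGroup.sr (a + (b - a) * i) := fun g => by
    have hg : g ∈ Subgroup.closure (Set.range (RACG.of Γ)) :=
      RACG.closure_range_of Γ ▸ Subgroup.mem_top g
    induction hg using Subgroup.closure_induction with
    | mem g hg =>
      obtain ⟨u, rfl⟩ := hg
      by_cases h1 : u = p.1.1
      · exact ⟨0, Or.inr (by rw [h1, ha]; ring_nf)⟩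
      · by_cases h2 : u = p.1.2
        · exact ⟨1, Or.inr (by rw [h2, hb]; ring_nf)⟩
        · exact ⟨0, Or.inl (by
            rw [h.dihedralProj_apply_of_ne hφ p h1 h2, mul_zero, DihedralGroup.one_def])⟩
    | one => exact ⟨0, Or.inl (by rw [map_one, map_one, mul_zero, DihedralGroup.one_def])⟩
    | mul x y _ _ hx hy =>
      obtain ⟨i, hi⟩ := hx
      obtain ⟨j, hj⟩ := hy
      rw [map_mul, map_mul]
      rcases hi with hi | hi <;> rcases hj with hj | hj <;> rw [hi, hj]
      · exact ⟨i + j, Or.inl (by rw [DihedralGroup.r_mul_r]; ring_nf)⟩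
      · exact ⟨j - i, Or.inr (by rw [DihedralGroup.r_mul_sr]; ring_nf)⟩
      · exact ⟨i + j, Or.inr (by rw [DihedralGroup.sr_mul_r]; ring_nf)⟩
      · exact ⟨j - i, Or.inl (by rw [DihedralGroup.sr_mul_sr]; ring_nf)⟩
    | inv x _ hx =>
      obtain ⟨i, hi⟩ := hx
      rw [map_inv, map_inv]
      rcases hi with hi | hi <;> rw [hi]
      · exact ⟨-i, Or.inl (by rw [DihedralGroup.inv_r]; ring_nf)⟩
      · exact ⟨i, Or.inr (by rw [DihedralGroup.inv_sr])⟩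
  obtain ⟨i, hi⟩ := key (φ⁻¹ (translation p))
  rw [MulAut.apply_inv_self, translation, map_mul, dihedralProj_of_fst, dihedralProj_of_snd,
    DihedralGroup.sr_mul_sr, sub_zero] at hi
  rcases hi with hi | hi
  · rw [DihedralGroup.r.injEq] at hi
    exact IsUnit.of_mul_eq_one _ hi.symm
  · exact absurd hi (by simp)

/-- The index of an element of the infinite dihedral group. -/
def dihedralIndex : DihedralGroup 0 → ℤ
  | DihedralGroup.r i => i
  | DihedralGroup.sr i => i

/-- A finite invariant of automorphisms that detects inner automorphisms by translations. -/
def autInvariant (φ : MulAut (RACG Γ)) (p : NonEdge Γ) : ZMod 4 × ZMod 4 :=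
  (dihedralIndex (dihedralProj p (φ (RACG.of Γ p.1.1))),
    dihedralIndex (dihedralProj p (φ (RACG.of Γ p.1.2))))

lemma exists_add_four_mul {a b a' b' : ℤ} (h : IsUnit (b - a)) (h' : IsUnit (b' - a'))
    (ha : (a : ZMod 4) = a') (hb : (b : ZMod 4) = b') :
    ∃ k : ℤ, a' = a + 4 * k ∧ b' = b + 4 * k := by
  obtain ⟨k, hk⟩ := (ZMod.intCast_eq_intCast_iff_dvd_sub _ _ _).1 ha
  obtain ⟨l, hl⟩ := (ZMod.intCast_eq_intCast_iff_dvd_sub _ _ _).1 hb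
  push_cast at hk hl
  refine ⟨k, by omega, ?_⟩
  rcases Int.isUnit_iff.1 h with h | h <;> rcases Int.isUnit_iff.1 h' with h' | h' <;> omega

lemma AtMostOneNonNeighbor.exists_dihedralProj_eq_conj (h : AtMostOneNonNeighbor Γ)
    (hφ : φ ∈ translationAut Γ) (hψ : ψ ∈ translationAut Γ) (p : NonEdge Γ)
    (heq : autInvariant φ p = autInvariant ψ p) : ∃ k : ℤ, ∀ u,
      dihedralProj p (ψ (RACG.of Γ u)) = DihedralGroup.r (Int.cast k : ZMod 0) *
        dihedralProj p (φ (RACG.of Γ u)) * (DihedralGroup.r (Int.cast k : ZMod 0))⁻¹ := by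
  obtain ⟨a, ha⟩ := h.exists_dihedralProj_fst hφ p
  obtain ⟨b, hb⟩ := h.exists_dihedralProj_snd hφ p
  obtain ⟨a', ha'⟩ := h.exists_dihedralProj_fst hψ p
  obtain ⟨b', hb'⟩ := h.exists_dihedralProj_snd hψ p
  rw [autInvariant, autInvariant, ha, hb, ha', hb', Prod.mk.injEq] at heq
  obtain ⟨k, hk, hk'⟩ := exists_add_four_mul (h.isUnit_sub hφ p ha hb) (h.isUnit_sub hψ p ha' hb')
    heq.1 heq.2
  have hconj : ∀ i i' : ZMod 0, i' = i + 4 * Int.cast k → (DihedralGroup.sr i' : DihedralGroup 0) =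
      DihedralGroup.r (Int.cast (-2 * k) : ZMod 0) * DihedralGroup.sr i *
        (DihedralGroup.r (Int.cast (-2 * k) : ZMod 0))⁻¹ := fun i i' hi => by
    rw [DihedralGroup.r_mul_sr, DihedralGroup.inv_r, DihedralGroup.sr_mul_r, hi]
    push_cast
    ring_nf
  refine ⟨-2 * k, fun u => ?_⟩
  by_cases h1 : u = p.1.1
  · rw [h1, ha, ha']
    exact hconj a a' hk
  · by_cases h2 : u = p.1.2
    · rw [h2, hb, hb']
      exact hconj b b' hk'
    · rw [h.dihedralProj_apply_of_ne hφ p h1 h2, h.dihedralProj_apply_of_ne hψ p h1 h2, mul_one,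
        mul_inv_cancel]

lemma AtMostOneNonNeighbor.mul_inv_mem_conj (h : AtMostOneNonNeighbor Γ)
    (hφ : φ ∈ translationAut Γ) (hψ : ψ ∈ translationAut Γ)
    (heq : autInvariant φ = autInvariant ψ) :
    ψ * φ⁻¹ ∈ MulAut.conj '' (translationSubgroup Γ : Set (RACG Γ)) := by
  choose k hk using fun p => h.exists_dihedralProj_eq_conj hφ hψ p (congr_fun heq p)
  refine ⟨translationProd k, translationProd_mem k, eq_mul_inv_of_mul_eq ?_⟩
  have hgen : ∀ u, translationProd k * φ (RACG.of Γ u) * (translationProd k)⁻¹ =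
      ψ (RACG.of Γ u) := fun u => by
    have hT : QuotientGroup.mk' (translationSubgroup Γ) (translationProd k) = 1 :=
      (QuotientGroup.eq_one_iff _).2 (translationProd_mem k)
    refine inv_mul_eq_one.1 (h.eq_one_of_dihedralProj (QuotientGroup.eq.1 ?_) fun p => ?_)
    · change QuotientGroup.mk' _ _ = QuotientGroup.mk' _ _
      rw [map_mul, map_mul, map_inv, hT, inv_one, mul_one, one_mul,
        mk_apply_of_mem_translationAut hφ, mk_apply_of_mem_translationAut hψ]
    · rw [map_mul, map_inv, map_mul, map_mul, map_inv, h.dihedralProj_translationProd, hk p u,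
        inv_mul_cancel]
  have hhom : (MulAut.conj (translationProd k) * φ).toMonoidHom = ψ.toMonoidHom :=
    RACG.hom_ext hgen
  exact MulEquiv.ext fun g => DFunLike.congr_fun hhom g

end Automorphism

end Fintype

lemma AtMostOneNonNeighbor.boundedlyGenerated_mulAut [Finite V] (h : AtMostOneNonNeighbor Γ) :
    BoundedlyGenerated (MulAut (RACG Γ)) := by
  have := Fintype.ofFinite (NonEdge Γ)
  have := h.normal_translationSubgroup
  have := finite_quotient_translationSubgroup (Γ := Γ)
  have := finite_monoidHom (RACG Γ) (RACG Γ ⧸ translationSubgroup Γ)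
  have hker : BoundedlyGeneratedSet (translationAut Γ : Set (MulAut (RACG Γ))) :=
    h.boundedlyGeneratedSet_conj.of_finite_fibres autInvariant
      fun φ hφ ψ hψ heq => h.mul_inv_mem_conj hφ hψ heq
  obtain ⟨l, hl⟩ := hker.of_finite_fibres (X := Set.univ)
    (autActHom (RACG Γ) (RACG Γ ⧸ translationSubgroup Γ)) fun φ _ ψ _ heq => by
      rw [SetLike.mem_coe, translationAut, MonoidHom.mem_ker, map_mul, map_inv, heq,
        mul_inv_cancel]
  exact ⟨l, fun g => hl g (Set.mem_univ g)⟩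

end NonEdge

/-- `Aut(C_Γ)` is boundedly generated iff every vertex of `Γ` is non-adjacent to at most one
other vertex. -/
theorem racg_aut_boundedlyGenerated_iff {V : Type} [Fintype V] (Γ : SimpleGraph V) :
    BoundedlyGenerated (MulAut (RACG Γ)) ↔
      (∀ u v w : V, v ≠ u → w ≠ u → ¬Γ.Adj u v → ¬Γ.Adj u w → v = w) := by
  refine ⟨fun hG u v w hv hw huv huw => ?_, fun h => ?_⟩
  · by_contra hvw
    exact not_boundedlyGenerated_mulAut_racg hvw hv hw huv huw hG
  · let _ : LinearOrder V := LinearOrder.lift' _ (Fintype.equivFin V).injective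
    exact AtMostOneNonNeighbor.boundedlyGenerated_mulAut h
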